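/- Let T be a symmetric positive-definite N_v×N_v matrix, Q an N_h×N_h symmetric matrix with Q − WᵀT⁻¹W positive definite, W an N_h×N_v matrix, B_v ∈ ℝ^{N_v}, B_h ∈ ℝ^{N_h}. Then the function P(v) = √(det T/(2π)^{N_v}) · exp(−(1/2)(v+T⁻¹B_v)ᵀT(v+T⁻¹B_v)) · θ̃(B_hᵀ + vᵀW | Q) / θ̃(B_hᵀ − B_vᵀT⁻¹W | Q − WᵀT⁻¹W) is a probability density: ∫_{ℝ^{N_v}} P(v) dv = 1. -/

import Mathlib

open MeasureTheory
open scoped BigOperators Matrix Real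

/-- Rescaled Riemann-Theta function `θ̃(z|Ω) = ∑_{n∈ℤ^k} exp(−(1/2)nᵀΩn + nᵀz)`. -/
noncomputable def tTheta {k : ℕ} (z : Fin k → ℝ) (Ω : Matrix (Fin k) (Fin k) ℝ) : ℝ :=
  ∑' n : Fin k → ℤ,
    Real.exp (-(1/2) * ((fun i => ((n i : ℝ))) ⬝ᵥ Ω.mulVec (fun i => ((n i : ℝ))))
      + (fun i => ((n i : ℝ))) ⬝ᵥ z)

open scoped MatrixOrder Matrix.Norms.L2Operator in
theorem Matrix.PosDef.exists_eq_transpose_mul_self {k : ℕ} {S : Matrix (Fin k) (Fin k) ℝ}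
    (hS : S.PosDef) : ∃ B : Matrix (Fin k) (Fin k) ℝ, B.det ≠ 0 ∧ S = Bᵀ * B := by
  obtain ⟨B, hB⟩ := CStarAlgebra.nonneg_iff_eq_star_mul_self.mp hS.posSemidef.nonneg
  rw [Matrix.star_eq_conjTranspose, Matrix.conjTranspose_eq_transpose_of_trivial] at hB
  refine ⟨B, fun h => hS.det_pos.ne' ?_, hB⟩
  rw [hB, Matrix.det_mul, h, mul_zero]

theorem Matrix.dotProduct_transpose_mul_self_mulVec {k : ℕ} (B : Matrix (Fin k) (Fin k) ℝ)
    (x : Fin k → ℝ) : x ⬝ᵥ (Bᵀ * B) *ᵥ x = ∑ i, (B *ᵥ x) i ^ 2 := by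
  rw [← Matrix.mulVec_mulVec, Matrix.mulVec_transpose, dotProduct_comm,
    ← Matrix.dotProduct_mulVec]
  simp [dotProduct, sq]

/-- A positive definite quadratic form dominates a positive multiple of the sum of squares. -/
theorem Matrix.PosDef.exists_mul_sum_sq_le {k : ℕ} {S : Matrix (Fin k) (Fin k) ℝ}
    (hS : S.PosDef) : ∃ c > 0, ∀ x : Fin k → ℝ, c * ∑ i, x i ^ 2 ≤ x ⬝ᵥ S *ᵥ x := by
  obtain ⟨B, hB, rfl⟩ := hS.exists_eq_transpose_mul_self
  set C : ℝ := ∑ i, ∑ j, B⁻¹ i j ^ 2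
  have hC : 0 ≤ C := by positivity
  refine ⟨(C + 1)⁻¹, by positivity, fun x => ?_⟩
  rw [Matrix.dotProduct_transpose_mul_self_mulVec, inv_mul_le_iff₀ (by positivity)]
  set y := B *ᵥ x with hy
  have hx : x = B⁻¹ *ᵥ y := by
    rw [hy, Matrix.mulVec_mulVec, Matrix.nonsing_inv_mul _ hB.isUnit, Matrix.one_mulVec]
  calc ∑ i, x i ^ 2 ≤ ∑ i, (∑ j, B⁻¹ i j ^ 2) * ∑ j, y j ^ 2 := by
        refine Finset.sum_le_sum fun i _ => ?_
        rw [hx]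
        exact Finset.sum_mul_sq_le_sq_mul_sq Finset.univ (B⁻¹ i) y
    _ = C * ∑ j, y j ^ 2 := by rw [Finset.sum_mul]
    _ ≤ (C + 1) * ∑ j, y j ^ 2 := by gcongr; linarith

theorem Summable.prod_fin {k : ℕ} {f : Fin k → ℤ → ℝ} (hf : ∀ i, Summable (f i))
    (h0 : ∀ i m, 0 ≤ f i m) : Summable fun n : Fin k → ℤ => ∏ i, f i (n i) := by
  induction k with
  | zero => exact Summable.of_finite
  | succ k ih =>
    rw [← (Fin.consEquiv fun _ => ℤ).summable_iff]
    have := (hf 0).mul_of_nonneg (ih (fun i => hf i.succ) fun i => h0 i.succ) (h0 0)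
      fun n => Finset.prod_nonneg fun i _ => h0 i.succ _
    refine this.congr fun n => ?_
    simp [Fin.consEquiv, Fin.prod_univ_succ]

theorem summable_exp_neg_mul_sq_add_mul {a : ℝ} (ha : 0 < a) (b : ℝ) :
    Summable fun m : ℤ => Real.exp (-a * (m : ℝ) ^ 2 + m * b) := by
  refine (summable_pow_mul_jacobiTheta₂_term_bound (|b| / (2 * π))
    (div_pos ha Real.pi_pos) 0).of_nonneg_of_le (fun _ => (Real.exp_pos _).le) fun m => ?_
  rw [pow_zero, one_mul, Real.exp_le_exp]
  have h : (m : ℝ) * b ≤ |b| * |(m : ℝ)| := by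
    rw [mul_comm, ← abs_mul]; exact le_abs_self _
  have h' : -π * (a / π * (m : ℝ) ^ 2 - 2 * (|b| / (2 * π)) * |(m : ℝ)|)
      = -a * (m : ℝ) ^ 2 + |b| * |(m : ℝ)| := by
    field_simp; ring
  push_cast
  linarith

theorem summable_tTheta {k : ℕ} (z : Fin k → ℝ) {S : Matrix (Fin k) (Fin k) ℝ} (hS : S.PosDef) :
    Summable fun n : Fin k → ℤ =>
      Real.exp (-(1/2) * ((fun i => (n i : ℝ)) ⬝ᵥ S *ᵥ (fun i => (n i : ℝ)))
        + (fun i => (n i : ℝ)) ⬝ᵥ z) := by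
  obtain ⟨c, hc, h⟩ := hS.exists_mul_sum_sq_le
  refine (Summable.prod_fin (fun i => summable_exp_neg_mul_sq_add_mul (half_pos hc) (z i))
    fun _ _ => (Real.exp_pos _).le).of_nonneg_of_le (fun _ => (Real.exp_pos _).le) fun n => ?_
  rw [← Real.exp_sum, Real.exp_le_exp, Finset.sum_add_distrib, ← Finset.mul_sum]
  have := h fun i => (n i : ℝ)
  simp only [dotProduct] at this ⊢
  linarith

theorem tTheta_pos {k : ℕ} (z : Fin k → ℝ) {S : Matrix (Fin k) (Fin k) ℝ} (hS : S.PosDef) :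
    0 < tTheta z S :=
  (summable_tTheta z hS).tsum_pos (fun _ => (Real.exp_pos _).le) 0 (Real.exp_pos _)

section Gaussian

variable {k : ℕ} {T : Matrix (Fin k) (Fin k) ℝ}

theorem integrable_exp_neg_half_sum_sq :
    Integrable fun y : Fin k → ℝ => Real.exp (-(1/2) * ∑ i, y i ^ 2) := by
  simp_rw [Finset.mul_sum, Real.exp_sum]
  exact Integrable.fintype_prod (f := fun _ (t : ℝ) => Real.exp (-(1/2) * t ^ 2))
    fun _ => integrable_exp_neg_mul_sq (by norm_num)

theorem integral_exp_neg_half_sum_sq :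
    ∫ y : Fin k → ℝ, Real.exp (-(1/2) * ∑ i, y i ^ 2) = √(2 * π) ^ k := by
  simp_rw [Finset.mul_sum, Real.exp_sum]
  rw [integral_fintype_prod_volume_eq_pow (fun t : ℝ => Real.exp (-(1/2) * t ^ 2)),
    integral_gaussian, Fintype.card_fin]
  congr 2
  ring

theorem Matrix.PosDef.integrable_exp_neg_half_quadraticForm (hT : T.PosDef) :
    Integrable fun w : Fin k → ℝ => Real.exp (-(1/2) * (w ⬝ᵥ T *ᵥ w)) := by
  obtain ⟨c, hc, h⟩ := hT.exists_mul_sum_sq_le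
  have hI : Integrable fun w : Fin k → ℝ => ∏ i, Real.exp (-(c/2) * w i ^ 2) :=
    Integrable.fintype_prod (f := fun _ (t : ℝ) => Real.exp (-(c/2) * t ^ 2))
      fun _ => integrable_exp_neg_mul_sq (half_pos hc)
  refine hI.mono' (Continuous.aestronglyMeasurable (by fun_prop)) (.of_forall fun w => ?_)
  rw [Real.norm_of_nonneg (Real.exp_pos _).le, ← Real.exp_sum, Real.exp_le_exp, ← Finset.mul_sum]
  linarith [h w]

theorem Matrix.PosDef.integral_exp_neg_half_quadraticForm (hT : T.PosDef) :
    ∫ w : Fin k → ℝ, Real.exp (-(1/2) * (w ⬝ᵥ T *ᵥ w)) = √((2 * π) ^ k / T.det) := by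
  obtain ⟨B, hB, rfl⟩ := hT.exists_eq_transpose_mul_self
  simp_rw [Matrix.dotProduct_transpose_mul_self_mulVec]
  have hmap := Real.map_matrix_volume_pi_eq_smul_volume_pi hB
  have hB' : Continuous (Matrix.toLin' B) := LinearMap.continuous_of_finiteDimensional _
  have := integral_map (μ := volume) hB'.aemeasurable
    (f := fun y : Fin k → ℝ => Real.exp (-(1/2) * ∑ i, y i ^ 2))
    (Continuous.aestronglyMeasurable (by fun_prop))
  rw [hmap, integral_smul_measure, integral_exp_neg_half_sum_sq,
    ENNReal.toReal_ofReal (abs_nonneg _)] at this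
  simp only [Matrix.toLin'_apply] at this
  rw [← this, Matrix.det_mul, Matrix.det_transpose, Real.sqrt_div (by positivity),
    Real.sqrt_mul_self_eq_abs, abs_inv, smul_eq_mul, div_eq_inv_mul]
  congr 1
  exact ((Real.sqrt_eq_iff_mul_self_eq (by positivity) (by positivity)).2 (by
    rw [← mul_pow, Real.mul_self_sqrt (by positivity)])).symm

theorem Matrix.PosDef.integral_gaussianDensity (hT : T.PosDef) :
    ∫ w : Fin k → ℝ, √(T.det / (2 * π) ^ k) * Real.exp (-(1/2) * (w ⬝ᵥ T *ᵥ w)) = 1 := by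
  have := hT.det_pos
  rw [integral_const_mul, hT.integral_exp_neg_half_quadraticForm, ← Real.sqrt_mul (by positivity),
    div_mul_div_cancel₀ (by positivity), div_self this.ne', Real.sqrt_one]

end Gaussian

/-- Completing the square in `v`: after adding a linear coupling `x ⬝ᵥ (v ᵥ* W)` to the visible
quadratic form, the shift of `v` absorbs the coupling and leaves the Schur complement in `x`. -/
theorem Matrix.PosDef.neg_half_quadraticForm_add_coupling {k m : ℕ}
    {T : Matrix (Fin k) (Fin k) ℝ} (hT : T.PosDef)
    (Q : Matrix (Fin m) (Fin m) ℝ) (W : Matrix (Fin k) (Fin m) ℝ)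
    (b v : Fin k → ℝ) (c x : Fin m → ℝ) :
    -(1/2) * ((v + T⁻¹ *ᵥ b) ⬝ᵥ T *ᵥ (v + T⁻¹ *ᵥ b))
        + (-(1/2) * (x ⬝ᵥ Q *ᵥ x) + x ⬝ᵥ (c + v ᵥ* W))
      = -(1/2) * ((v + (T⁻¹ *ᵥ b - T⁻¹ *ᵥ W *ᵥ x)) ⬝ᵥ T *ᵥ (v + (T⁻¹ *ᵥ b - T⁻¹ *ᵥ W *ᵥ x)))
        + (-(1/2) * (x ⬝ᵥ (Q - Wᵀ * T⁻¹ * W) *ᵥ x) + x ⬝ᵥ (c - b ᵥ* (T⁻¹ * W))) := by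
  have hsymm (y z : Fin k → ℝ) : y ⬝ᵥ T *ᵥ z = z ⬝ᵥ T *ᵥ y := by
    rw [Matrix.dotProduct_mulVec, ← Matrix.mulVec_transpose,
      ← Matrix.conjTranspose_eq_transpose_of_trivial, hT.isHermitian.eq, dotProduct_comm]
  have hinv (y : Fin k → ℝ) : T *ᵥ T⁻¹ *ᵥ y = y := by
    rw [Matrix.mulVec_mulVec, Matrix.mul_nonsing_inv _ hT.det_pos.ne'.isUnit, Matrix.one_mulVec]
  set q := T⁻¹ *ᵥ b with hq
  set p := T⁻¹ *ᵥ W *ᵥ x with hp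
  have hTp : T *ᵥ p = W *ᵥ x := hinv _
  have hTq : T *ᵥ q = b := hinv _
  have h1 : x ⬝ᵥ (v ᵥ* W) = v ⬝ᵥ T *ᵥ p := by
    rw [hTp, dotProduct_comm, Matrix.dotProduct_mulVec]
  have h2 : x ⬝ᵥ (b ᵥ* (T⁻¹ * W)) = q ⬝ᵥ T *ᵥ p := by
    rw [dotProduct_comm, ← Matrix.dotProduct_mulVec, ← Matrix.mulVec_mulVec, ← hp, hsymm, hTq,
      dotProduct_comm]
  have h3 : x ⬝ᵥ (Wᵀ * T⁻¹ * W) *ᵥ x = p ⬝ᵥ T *ᵥ p := by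
    rw [← Matrix.mulVec_mulVec, ← Matrix.mulVec_mulVec, ← hp, Matrix.mulVec_transpose,
      dotProduct_comm, ← Matrix.dotProduct_mulVec, hTp]
  simp only [Matrix.sub_mulVec, Matrix.mulVec_add, Matrix.mulVec_sub, dotProduct_add,
    dotProduct_sub, add_dotProduct, sub_dotProduct, h1, h2, h3]
  rw [hsymm p v, hsymm q v, hsymm p q]
  ring

/-- The visible-sector density of the RTBM is normalized: `∫ P(v) dv = 1`. -/
theorem RTBM_density_normalized (Nv Nh : ℕ)
    (T : Matrix (Fin Nv) (Fin Nv) ℝ) (hT : T.PosDef)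
    (Q : Matrix (Fin Nh) (Fin Nh) ℝ) (hQ : Qᵀ = Q)
    (W : Matrix (Fin Nv) (Fin Nh) ℝ)
    (Bv : Fin Nv → ℝ) (Bh : Fin Nh → ℝ)
    (hSchur : (Q - Wᵀ * T⁻¹ * W).PosDef) :
    (∫ v : Fin Nv → ℝ,
        Real.sqrt (T.det / (2 * π) ^ Nv)
          * Real.exp (-(1/2) * ((v + T⁻¹.mulVec Bv) ⬝ᵥ T.mulVec (v + T⁻¹.mulVec Bv)))
          * (tTheta (Bh + Matrix.vecMul v W) Q
              / tTheta (Bh - Matrix.vecMul Bv (T⁻¹ * W)) (Q - Wᵀ * T⁻¹ * W)))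
      = 1 := by
  set S := Q - Wᵀ * T⁻¹ * W
  set z := Bh - Matrix.vecMul Bv (T⁻¹ * W)
  set g : (Fin Nv → ℝ) → ℝ :=
    fun w => √(T.det / (2 * π) ^ Nv) * Real.exp (-(1/2) * (w ⬝ᵥ T *ᵥ w))
  have hg_int : Integrable g := hT.integrable_exp_neg_half_quadraticForm.const_mul _
  have hg_nonneg (w) : 0 ≤ g w := by positivity
  set s : (Fin Nh → ℤ) → Fin Nv → ℝ :=
    fun n => T⁻¹ *ᵥ Bv - T⁻¹ *ᵥ W *ᵥ (fun i => (n i : ℝ))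
  set K : (Fin Nh → ℤ) → ℝ := fun n =>
    Real.exp (-(1/2) * ((fun i => (n i : ℝ)) ⬝ᵥ S *ᵥ (fun i => (n i : ℝ)))
      + (fun i => (n i : ℝ)) ⬝ᵥ z)
  have hF_integral (n : Fin Nh → ℤ) : ∫ v, g (v + s n) * K n = K n := by
    rw [integral_mul_const, integral_add_right_eq_self g, hT.integral_gaussianDensity, one_mul]
  have hF_norm (n : Fin Nh → ℤ) : ∫ v, ‖g (v + s n) * K n‖ = K n := by
    refine Eq.trans (congrArg _ (funext fun v => ?_)) (hF_integral n)
    exact Real.norm_of_nonneg (mul_nonneg (hg_nonneg _) (Real.exp_pos _).le)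
  have hpt (v : Fin Nv → ℝ) :
      √(T.det / (2 * π) ^ Nv)
          * Real.exp (-(1/2) * ((v + T⁻¹.mulVec Bv) ⬝ᵥ T.mulVec (v + T⁻¹.mulVec Bv)))
          * (tTheta (Bh + Matrix.vecMul v W) Q / tTheta z S)
        = (∑' n, g (v + s n) * K n) / tTheta z S := by
    rw [← mul_div_assoc, tTheta, ← tsum_mul_left]
    congr 2
    funext n
    rw [mul_assoc, ← Real.exp_add, hT.neg_half_quadraticForm_add_coupling, Real.exp_add,
      ← mul_assoc]
  simp_rw [hpt]
  rw [integral_div, ← integral_tsum_of_summable_integral_norm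
    (fun n => (hg_int.comp_add_right (s n)).mul_const _)
    (by simpa only [hF_norm] using summable_tTheta z hSchur)]
  simp_rw [hF_integral]
  exact div_self (tTheta_pos z hSchur).ne'
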